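/- arXiv:2108.05418 — 6 statements merged into one kernel-verified Lean document; each statement's English description precedes it below -/
import Mathlib

section
/- For every t with −π < t < 0 and every τ > 0, the generalized secant hyperbolic density integrates to one: ∫_ℝ (c₁/τ)·exp(c₂θ/τ)/(exp(2c₂θ/τ) + 2a·exp(c₂θ/τ) + 1) dθ = 1, where a = cos t, c₂ = √((π²−t²)/3), and c₁ = (sin t / t)·c₂. -/
open Real MeasureTheory

/-- A continuous nonnegative derivative of a function with finite limits at both ends
is integrable over the line. -/
theorem integrable_of_hasDerivAt_of_nonneg_of_tendsto {f f' : ℝ → ℝ} {m n : ℝ}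
    (hderiv : ∀ x, HasDerivAt f (f' x) x) (hcont : Continuous f') (hpos : ∀ x, 0 ≤ f' x)
    (hbot : Filter.Tendsto f Filter.atBot (nhds m))
    (htop : Filter.Tendsto f Filter.atTop (nhds n)) : Integrable f' := by
  refine integrable_of_intervalIntegral_norm_tendsto (n - m) (l := Filter.atTop)
    (a := fun x : ℝ => -x) (b := fun x => x) (fun x => ?_)
    Filter.tendsto_neg_atTop_atBot Filter.tendsto_id ?_
  · exact (hcont.integrableOn_Icc).mono_set Set.Ioc_subset_Icc_self
  · refine (htop.sub (hbot.comp Filter.tendsto_neg_atTop_atBot)).congr fun x => ?_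
    simp_rw [Real.norm_of_nonneg (hpos _)]
    exact (intervalIntegral.integral_eq_sub_of_hasDerivAt (fun y _ => hderiv y)
      (hcont.intervalIntegrable _ _)).symm

/-- The principal arctangent of the cotangent on `(-π, 0)`. -/
theorem arctan_cos_div_sin_of_neg {t : ℝ} (ht₁ : -π < t) (ht₂ : t < 0) :
    arctan (cos t / sin t) = -(π / 2) - t := by
  have h : tan (-(π / 2) - t) = cos t / sin t := by
    rw [← neg_add', tan_neg, add_comm, tan_eq_sin_div_cos, sin_add_pi_div_two,
      cos_add_pi_div_two, div_neg, neg_neg]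
  rw [← h, arctan_tan (by linarith) (by linarith)]

/-- For −π < t < 0 and τ > 0 the generalized secant hyperbolic
density integrates to one, where a = cos t, c₂ = √((π²−t²)/3),
c₁ = (sin t / t)·c₂. -/
theorem gsh_integrates_to_one_neg
    (t τ : ℝ) (ht₁ : -Real.pi < t) (ht₂ : t < 0) (hτ : 0 < τ)
    (a c₁ c₂ : ℝ)
    (ha : a = Real.cos t)
    (hc₂ : c₂ = Real.sqrt ((Real.pi ^ 2 - t ^ 2) / 3))
    (hc₁ : c₁ = (Real.sin t / t) * c₂) :
    ∫ θ : ℝ, (c₁ / τ) * Real.exp (c₂ * θ / τ) /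
      (Real.exp (2 * c₂ * θ / τ) + 2 * a * Real.exp (c₂ * θ / τ) + 1) = 1 := by
  have hs : sin t < 0 := sin_neg_of_neg_of_neg_pi_lt ht₂ ht₁
  have hc : 0 < c₂ := by
    rw [hc₂]
    exact Real.sqrt_pos.2 (by nlinarith)
  have hc₁_pos : 0 < c₁ := hc₁ ▸ mul_pos (div_pos_of_neg_of_neg hs ht₂) hc
  have hden (θ : ℝ) : exp (2 * c₂ * θ / τ) + 2 * a * exp (c₂ * θ / τ) + 1 =
      sin t ^ 2 + (exp (c₂ * θ / τ) + cos t) ^ 2 := by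
    have h : exp (2 * c₂ * θ / τ) = exp (c₂ * θ / τ) ^ 2 := by
      rw [← exp_nat_mul]
      congr 1
      push_cast
      ring
    rw [h, ha]
    linear_combination -(sin_sq_add_cos_sq t)
  have hden_pos (θ : ℝ) : 0 < sin t ^ 2 + (exp (c₂ * θ / τ) + cos t) ^ 2 := by
    have := sq_pos_of_neg hs
    positivity
  simp_rw [hden]
  have hderiv (θ : ℝ) : HasDerivAt
      (fun θ => 1 / t * arctan ((exp (c₂ * θ / τ) + cos t) / sin t))
      (c₁ / τ * exp (c₂ * θ / τ) / (sin t ^ 2 + (exp (c₂ * θ / τ) + cos t) ^ 2)) θ := by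
    have h := (((((hasDerivAt_id θ).const_mul c₂).div_const τ).exp.add_const
      (cos t)).div_const (sin t)).arctan.const_mul (1 / t)
    simp only [id, mul_one] at h
    refine h.congr_deriv ?_
    have h₁ := hs.ne
    have h₂ := ht₂.ne
    have h₃ := (hden_pos θ).ne'
    have h₄ : 1 + ((exp (c₂ * θ / τ) + cos t) / sin t) ^ 2 =
        (sin t ^ 2 + (exp (c₂ * θ / τ) + cos t) ^ 2) / sin t ^ 2 := by
      field_simp
    rw [h₄, hc₁]
    field_simp
  have hlin_top : Filter.Tendsto (fun θ => c₂ * θ / τ) Filter.atTop Filter.atTop :=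
    (Filter.tendsto_id.const_mul_atTop hc).atTop_div_const hτ
  have hlin_bot : Filter.Tendsto (fun θ => c₂ * θ / τ) Filter.atBot Filter.atBot :=
    (Filter.tendsto_id.const_mul_atBot hc).atBot_div_const hτ
  have htop := ((tendsto_arctan_atBot.mono_right nhdsWithin_le_nhds).comp
    ((Filter.tendsto_atTop_add_const_right _ (cos t)
      (tendsto_exp_atTop.comp hlin_top)).atTop_div_const_of_neg hs)).const_mul (1 / t)
  have hbot := ((continuous_arctan.tendsto _).comp
    (((tendsto_exp_atBot.comp hlin_bot).add_const (cos t)).div_const (sin t))).const_mul (1 / t)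
  have hcont : Continuous fun θ : ℝ =>
      c₁ / τ * exp (c₂ * θ / τ) / (sin t ^ 2 + (exp (c₂ * θ / τ) + cos t) ^ 2) :=
    Continuous.div₀ (by fun_prop) (by fun_prop) fun θ => (hden_pos θ).ne'
  have hint := integrable_of_hasDerivAt_of_nonneg_of_tendsto hderiv hcont
    (fun θ => by have := hden_pos θ; positivity) hbot htop
  rw [integral_of_hasDerivAt_of_tendsto hderiv hint hbot htop, zero_add,
    arctan_cos_div_sin_of_neg ht₁ ht₂]
  have := ht₂.ne
  field_simp
  ring
end

section
/- For every t > 0 and every τ > 0, the generalized secant hyperbolic density integrates to one: ∫_ℝ (c₁/τ)·exp(c₂θ/τ)/(exp(2c₂θ/τ) + 2a·exp(c₂θ/τ) + 1) dθ = 1, where a = cosh t, c₂ = √((π²+t²)/3), and c₁ = (sinh t / t)·c₂. -/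
open Real MeasureTheory

open Filter Topology in
/-- A nonnegative continuous derivative of a function with limits at `±∞` is integrable, with
integral the difference of the limits. -/
theorem integral_eq_sub_of_hasDerivAt_of_nonneg {f f' : ℝ → ℝ} {m n : ℝ}
    (hderiv : ∀ x, HasDerivAt f (f' x) x) (hcont : Continuous f') (hnonneg : ∀ x, 0 ≤ f' x)
    (hbot : Tendsto f atBot (𝓝 m)) (htop : Tendsto f atTop (𝓝 n)) :
    ∫ x, f' x = n - m := by
  refine integral_of_hasDerivAt_of_tendsto hderiv ?_ hbot htop
  refine integrable_of_intervalIntegral_norm_tendsto (l := atTop) (a := fun x : ℝ => -x)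
    (b := fun x => x) (n - m) (fun x => hcont.integrableOn_Ioc) tendsto_neg_atTop_atBot
    tendsto_id ?_
  refine (htop.sub (hbot.comp tendsto_neg_atTop_atBot)).congr fun x => ?_
  simp only [Real.norm_of_nonneg (hnonneg _), Function.comp_apply]
  exact (intervalIntegral.integral_eq_sub_of_hasDerivAt (fun y _ => hderiv y)
    (hcont.intervalIntegrable _ _)).symm

theorem exp_two_mul_add_cosh_mul_exp_add_one (t y : ℝ) :
    exp (2 * y) + 2 * cosh t * exp y + 1 = (exp y + exp t) * (exp y + exp (-t)) := by
  have h : exp t * exp (-t) = 1 := by rw [← exp_add, add_neg_cancel, exp_zero]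
  rw [two_mul y, exp_add, cosh_eq]
  linear_combination -h

theorem hasDerivAt_log_one_sub_two_mul_sinh_div (t k x : ℝ) :
    HasDerivAt (fun x => log (1 - 2 * sinh t / (exp (k * x) + exp t)))
      (2 * sinh t * k * exp (k * x) /
        (exp (2 * (k * x)) + 2 * cosh t * exp (k * x) + 1)) x := by
  have hpos : 0 < exp (k * x) + exp t := by positivity
  have hpos' : 0 < exp (k * x) + exp (-t) := by positivity
  have heq : 1 - 2 * sinh t / (exp (k * x) + exp t)
      = (exp (k * x) + exp (-t)) / (exp (k * x) + exp t) := by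
    rw [sinh_eq]; field_simp; ring
  have hexp : HasDerivAt (fun x => exp (k * x) + exp t) (exp (k * x) * (k * 1)) x :=
    (((hasDerivAt_id x).const_mul k).exp).add_const _
  have hne : 1 - 2 * sinh t / (exp (k * x) + exp t) ≠ 0 := by
    rw [heq]; positivity
  refine ((((hasDerivAt_const x (2 * sinh t)).div hexp hpos.ne').const_sub 1).log
    hne).congr_deriv ?_
  simp only [Pi.div_apply]
  rw [heq, exp_two_mul_add_cosh_mul_exp_add_one]
  field_simp
  ring

open Filter Topology in
theorem tendsto_log_one_sub_two_mul_sinh_div_atTop (t : ℝ) {k : ℝ} (hk : 0 < k) :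
    Tendsto (fun x => log (1 - 2 * sinh t / (exp (k * x) + exp t))) atTop (𝓝 0) := by
  have hexp : Tendsto (fun x => exp (k * x) + exp t) atTop atTop :=
    tendsto_atTop_add_const_right _ _ (tendsto_exp_atTop.comp (tendsto_id.const_mul_atTop hk))
  have h := ((tendsto_const_nhds (x := 2 * sinh t)).div_atTop hexp).const_sub 1
  rw [sub_zero] at h
  simpa using h.log one_ne_zero

open Filter Topology in
theorem tendsto_log_one_sub_two_mul_sinh_div_atBot (t : ℝ) {k : ℝ} (hk : 0 < k) :
    Tendsto (fun x => log (1 - 2 * sinh t / (exp (k * x) + exp t))) atBot (𝓝 (-(2 * t))) := by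
  have hexp : Tendsto (fun x => exp (k * x) + exp t) atBot (𝓝 (0 + exp t)) :=
    (tendsto_exp_atBot.comp (tendsto_id.const_mul_atBot hk)).add_const _
  have heq : 1 - 2 * sinh t / (0 + exp t) = exp (-(2 * t)) := by
    have h : exp (-(2 * t)) * exp t = exp (-t) := by rw [← exp_add]; ring_nf
    rw [sinh_eq, zero_add]
    field_simp
    linear_combination -h
  have h := ((tendsto_const_nhds (x := 2 * sinh t)).div hexp (by positivity)).const_sub 1
  rw [heq] at h
  simpa using h.log (exp_ne_zero _)

/-- For t > 0 and τ > 0 the generalized secant hyperbolic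
density integrates to one, where a = cosh t, c₂ = √((π²+t²)/3),
c₁ = (sinh t / t)·c₂. -/
theorem gsh_integrates_to_one_pos
    (t τ : ℝ) (ht : 0 < t) (hτ : 0 < τ)
    (a c₁ c₂ : ℝ)
    (ha : a = Real.cosh t)
    (hc₂ : c₂ = Real.sqrt ((Real.pi ^ 2 + t ^ 2) / 3))
    (hc₁ : c₁ = (Real.sinh t / t) * c₂) :
    ∫ θ : ℝ, (c₁ / τ) * Real.exp (c₂ * θ / τ) /
      (Real.exp (2 * c₂ * θ / τ) + 2 * a * Real.exp (c₂ * θ / τ) + 1) = 1 := by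
  have hc₂pos : 0 < c₂ := by rw [hc₂]; positivity
  have hk : 0 < c₂ / τ := div_pos hc₂pos hτ
  have hcosh := cosh_pos t
  have hsinh : 0 < sinh t := sinh_pos_iff.2 ht
  have hc₁pos : 0 < c₁ := by rw [hc₁]; positivity
  have hden (θ : ℝ) : 0 < exp (2 * c₂ * θ / τ) + 2 * a * exp (c₂ * θ / τ) + 1 := by
    rw [ha]; positivity
  refine (integral_eq_sub_of_hasDerivAt_of_nonneg
    (f := fun θ => log (1 - 2 * sinh t / (exp (c₂ / τ * θ) + exp t)) / (2 * t))
    (m := -(2 * t) / (2 * t)) (n := 0 / (2 * t)) (fun θ => ?_) ?_ (fun θ => ?_)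
    ((tendsto_log_one_sub_two_mul_sinh_div_atBot t hk).div_const _)
    ((tendsto_log_one_sub_two_mul_sinh_div_atTop t hk).div_const _)).trans ?_
  · refine ((hasDerivAt_log_one_sub_two_mul_sinh_div t (c₂ / τ) θ).div_const (2 * t)).congr_deriv
      ?_
    rw [show c₂ * θ / τ = c₂ / τ * θ by ring,
      show 2 * c₂ * θ / τ = 2 * (c₂ / τ * θ) by ring, hc₁, ha]
    ring
  · exact Continuous.div (by fun_prop) (by fun_prop) fun θ => (hden θ).ne'
  · have := hden θ
    positivity
  · field_simp
    ring
end

section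
/- For every t with −π < t < 0 and every τ > 0, the second moment of the generalized secant hyperbolic density equals τ²: ∫_ℝ θ²·g(θ;τ,t) dθ = τ², where g(θ;τ,t) = (c₁/τ)·exp(c₂θ/τ)/(exp(2c₂θ/τ) + 2a·exp(c₂θ/τ) + 1) with a = cos t, c₂ = √((π²−t²)/3), c₁ = (sin t / t)·c₂. -/
open Real MeasureTheory

theorem hasSum_sin_nat_mul_div_cube {φ : ℝ} (h₀ : 0 ≤ φ) (h₁ : φ ≤ 2 * π) :
    HasSum (fun n : ℕ => sin (n * φ) / (n : ℝ) ^ 3)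
      (φ ^ 3 / 12 - π * φ ^ 2 / 4 + π ^ 2 * φ / 6) := by
  have hx : φ / (2 * π) ∈ Set.Icc (0 : ℝ) 1 :=
    ⟨by positivity, (div_le_one (by positivity)).2 h₁⟩
  convert hasSum_one_div_nat_pow_mul_sin one_ne_zero hx using 1
  · ext n
    rw [show 2 * π * n * (φ / (2 * π)) = n * φ by field_simp]
    ring
  · simp [Polynomial.bernoulli, Finset.sum_range_succ, Polynomial.eval_monomial,
      bernoulli_eq_zero_of_odd (show Odd 3 by decide), Nat.factorial, Nat.choose]
    field_simp
    ring

theorem hasSum_pow_mul_sin_nat_mul {r : ℝ} (hr₀ : 0 ≤ r) (hr₁ : r < 1) (φ : ℝ) :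
    HasSum (fun n : ℕ => r ^ n * sin (n * φ)) (r * sin φ / (1 - 2 * r * cos φ + r ^ 2)) := by
  have hz : ‖(r : ℂ) * Complex.exp (φ * Complex.I)‖ < 1 := by
    rwa [norm_mul, Complex.norm_exp_ofReal_mul_I, mul_one, Complex.norm_real, norm_of_nonneg hr₀]
  convert Complex.hasSum_im (hasSum_geometric_of_norm_lt_one hz) using 1
  · ext n
    rw [mul_pow, ← Complex.exp_nat_mul, ← mul_assoc, ← Complex.ofReal_pow, Complex.im_ofReal_mul,
      ← Complex.ofReal_natCast, ← Complex.ofReal_mul, Complex.exp_ofReal_mul_I_im]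
  · rw [Complex.inv_im, Complex.normSq_apply]
    simp [Complex.exp_ofReal_mul_I_re, Complex.exp_ofReal_mul_I_im]
    congr 1
    linear_combination (-r ^ 2) * sin_sq_add_cos_sq φ

theorem integrableOn_sq_mul_exp_neg_mul {b : ℝ} (hb : 0 < b) :
    IntegrableOn (fun x : ℝ => x ^ 2 * exp (-(b * x))) (Set.Ioi 0) := by
  simpa using integrableOn_rpow_mul_exp_neg_mul_rpow (s := 2) (p := 1) (by norm_num) one_pos hb

theorem integral_sq_mul_exp_neg_mul {b : ℝ} (hb : 0 < b) :
    ∫ x in Set.Ioi (0 : ℝ), x ^ 2 * exp (-(b * x)) = 2 / b ^ 3 := by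
  have h := integral_rpow_mul_exp_neg_mul_Ioi (a := 3) (by norm_num) hb
  have hΓ : Gamma 3 = 2 := by simp [Gamma_ofNat_eq_factorial, Nat.factorial]
  rw [hΓ, show (3 : ℝ) - 1 = (2 : ℕ) by norm_num, show (3 : ℝ) = (3 : ℕ) by norm_num] at h
  simp only [rpow_natCast] at h
  rw [h, one_div, inv_pow]
  ring

theorem integral_sq_mul_geometric_sin {φ : ℝ} (h₀ : 0 ≤ φ) (h₁ : φ ≤ 2 * π) :
    ∫ x in Set.Ioi (0 : ℝ), x ^ 2 *
        (exp (-x) * sin φ / (1 - 2 * exp (-x) * cos φ + exp (-x) ^ 2)) =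
      2 * (φ ^ 3 / 12 - π * φ ^ 2 / 4 + π ^ 2 * φ / 6) := by
  set F : ℕ → ℝ → ℝ := fun n x => sin (n * φ) * (x ^ 2 * exp (-(n * x))) with hF
  have hF₀ : F 0 = 0 := by ext x; simp [hF]
  have hF_int (n : ℕ) : IntegrableOn (F n) (Set.Ioi 0) := by
    rcases n.eq_zero_or_pos with rfl | hn
    · rw [hF₀]
      exact integrableOn_zero
    · exact (integrableOn_sq_mul_exp_neg_mul (Nat.cast_pos.2 hn)).const_mul _
  have hF_norm (n : ℕ) : ∫ x in Set.Ioi 0, ‖F n x‖ = |sin (n * φ)| * (2 / (n : ℝ) ^ 3) := by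
    rcases n.eq_zero_or_pos with rfl | hn
    · simp [hF₀]
    · rw [← integral_sq_mul_exp_neg_mul (Nat.cast_pos.2 hn), ← integral_const_mul]
      congr 1 with x
      rw [hF, norm_mul, norm_eq_abs, norm_of_nonneg (by positivity)]
  have hF_val (n : ℕ) : ∫ x in Set.Ioi 0, F n x = 2 * (sin (n * φ) / (n : ℝ) ^ 3) := by
    rcases n.eq_zero_or_pos with rfl | hn
    · simp [hF₀]
    · rw [hF, integral_const_mul, integral_sq_mul_exp_neg_mul (Nat.cast_pos.2 hn)]
      ring
  have hsum : Summable fun n => ∫ x in Set.Ioi 0, ‖F n x‖ := by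
    refine .of_nonneg_of_le (fun n => integral_nonneg fun x => norm_nonneg _) (fun n => ?_)
      ((summable_nat_pow_inv.2 (by norm_num : 1 < 3)).mul_left (2 : ℝ))
    rw [hF_norm, div_eq_mul_inv]
    exact mul_le_of_le_one_left (by positivity) (abs_sin_le_one _)
  have hswap := hasSum_integral_of_summable_integral_norm hF_int hsum
  simp only [hF_val] at hswap
  rw [← hswap.unique ((hasSum_sin_nat_mul_div_cube h₀ h₁).mul_left 2)]
  refine setIntegral_congr_fun measurableSet_Ioi fun x hx => ?_
  have hpt := (hasSum_pow_mul_sin_nat_mul (exp_pos (-x)).le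
    (exp_lt_one_iff.2 (neg_neg_of_pos hx)) φ).mul_left (x ^ 2)
  rw [← hpt.tsum_eq]
  refine tsum_congr fun n => ?_
  rw [hF, ← exp_nat_mul, mul_neg]
  ring

theorem integral_sq_mul_exp_div {t : ℝ} (h₀ : -π < t) (h₁ : t < 0) :
    ∫ x : ℝ, x ^ 2 * (exp x / (exp (2 * x) + 2 * cos t * exp x + 1)) =
      t / sin t * ((π ^ 2 - t ^ 2) / 3) := by
  have hsin : sin t ≠ 0 := (sin_neg_of_neg_of_neg_pi_lt h₁ h₀).ne
  set f : ℝ → ℝ := fun x => x ^ 2 *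
    (exp (-x) * sin (t + π) / (1 - 2 * exp (-x) * cos (t + π) + exp (-x) ^ 2)) with hf
  have hpos (y : ℝ) : 0 < y ^ 2 + 2 * cos t * y + 1 := by
    nlinarith [sq_nonneg (y + cos t), sin_sq_add_cos_sq t, pow_pos (abs_pos.2 hsin) 2,
      sq_abs (sin t)]
  have heven (x : ℝ) : x ^ 2 * (exp x / (exp (2 * x) + 2 * cos t * exp x + 1)) =
      (-(sin t)⁻¹) * f |x| := by
    have h2 : exp (2 * x) = exp x ^ 2 := by rw [← exp_nat_mul]; norm_cast
    have hd := (hpos (exp x)).ne'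
    simp only [hf, sin_add_pi, cos_add_pi, sq_abs, h2]
    rcases abs_cases x with ⟨hx, -⟩ | ⟨hx, -⟩
    · have hd' : 1 - 2 * (exp x)⁻¹ * -cos t + (exp x)⁻¹ ^ 2 ≠ 0 := by
        rw [show 1 - 2 * (exp x)⁻¹ * -cos t + (exp x)⁻¹ ^ 2
          = (exp x)⁻¹ ^ 2 + 2 * cos t * (exp x)⁻¹ + 1 by ring]
        exact (hpos _).ne'
      rw [hx, exp_neg]
      field_simp
      ring
    · have hd' : 1 - 2 * exp x * -cos t + exp x ^ 2 ≠ 0 := by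
        rw [show 1 - 2 * exp x * -cos t + exp x ^ 2
          = exp x ^ 2 + 2 * cos t * exp x + 1 by ring]
        exact hd
      rw [hx, neg_neg]
      field_simp
      ring
  simp only [heven]
  rw [integral_const_mul, integral_comp_abs (f := f), hf,
    integral_sq_mul_geometric_sin (by linarith) (by linarith [pi_pos])]
  field_simp
  ring

/-- For −π < t < 0 and τ > 0, the second moment of the
generalized secant hyperbolic density equals τ², where a = cos t,
c₂ = √((π²−t²)/3), c₁ = (sin t / t)·c₂. -/
theorem gsh_second_moment_neg
    (t τ : ℝ) (ht₁ : -Real.pi < t) (ht₂ : t < 0) (hτ : 0 < τ)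
    (a c₁ c₂ : ℝ)
    (ha : a = Real.cos t)
    (hc₂ : c₂ = Real.sqrt ((Real.pi ^ 2 - t ^ 2) / 3))
    (hc₁ : c₁ = (Real.sin t / t) * c₂) :
    ∫ θ : ℝ, θ ^ 2 * ((c₁ / τ) * Real.exp (c₂ * θ / τ) /
      (Real.exp (2 * c₂ * θ / τ) + 2 * a * Real.exp (c₂ * θ / τ) + 1)) = τ ^ 2 := by
  have hc : 0 < c₂ := by
    rw [hc₂]
    exact sqrt_pos.2 (by nlinarith)
  have hc_sq : c₂ ^ 2 = (π ^ 2 - t ^ 2) / 3 := by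
    rw [hc₂]
    exact sq_sqrt (by nlinarith)
  have hsin : sin t ≠ 0 := (sin_neg_of_neg_of_neg_pi_lt ht₂ ht₁).ne
  have hscale := Measure.integral_comp_mul_left
    (fun x : ℝ => x ^ 2 * (exp x / (exp (2 * x) + 2 * cos t * exp x + 1))) (c₂ / τ)
  rw [integral_sq_mul_exp_div ht₁ ht₂, ← hc_sq, abs_of_pos (by positivity), smul_eq_mul] at hscale
  have hint (θ : ℝ) : θ ^ 2 * ((c₁ / τ) * exp (c₂ * θ / τ) /
      (exp (2 * c₂ * θ / τ) + 2 * a * exp (c₂ * θ / τ) + 1)) =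
      c₁ * τ / c₂ ^ 2 * ((c₂ / τ * θ) ^ 2 * (exp (c₂ / τ * θ) /
        (exp (2 * (c₂ / τ * θ)) + 2 * cos t * exp (c₂ / τ * θ) + 1))) := by
    rw [ha, show c₂ * θ / τ = c₂ / τ * θ by ring,
      show 2 * c₂ * θ / τ = 2 * (c₂ / τ * θ) by ring]
    generalize exp (2 * (c₂ / τ * θ)) + 2 * cos t * exp (c₂ / τ * θ) + 1 = d
    generalize exp (c₂ / τ * θ) = y
    field_simp
  simp only [hint]
  rw [integral_const_mul, hscale, hc₁]
  have ht := ht₂.ne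
  field_simp
end

section
/- For every t > 0 and every τ > 0, the second moment of the generalized secant hyperbolic density equals τ²: ∫_ℝ θ²·g(θ;τ,t) dθ = τ², where g(θ;τ,t) = (c₁/τ)·exp(c₂θ/τ)/(exp(2c₂θ/τ) + 2a·exp(c₂θ/τ) + 1) with a = cosh t, c₂ = √((π²+t²)/3), c₁ = (sinh t / t)·c₂. -/
open Real MeasureTheory

/-- The density of the standard logistic distribution. -/
noncomputable def logisticDensity (x : ℝ) : ℝ := exp x / (1 + exp x) ^ 2

lemma logisticDensity_nonneg (x : ℝ) : 0 ≤ logisticDensity x := by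
  unfold logisticDensity; positivity

@[fun_prop]
lemma continuous_logisticDensity : Continuous logisticDensity := by
  unfold logisticDensity
  exact continuous_exp.div (by fun_prop) fun x => by positivity

lemma logisticDensity_eq_inv_cosh (x : ℝ) : logisticDensity x = (2 + 2 * cosh x)⁻¹ := by
  have hx := exp_pos x
  rw [logisticDensity, cosh_eq, exp_neg]
  field_simp
  ring

lemma logisticDensity_neg (x : ℝ) : logisticDensity (-x) = logisticDensity x := by
  simp [logisticDensity_eq_inv_cosh]

lemma one_add_sq_mul_logisticDensity_le (x : ℝ) :
    (1 + x ^ 2) * logisticDensity x ≤ 48 * (1 + x ^ 2)⁻¹ := by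
  have h1 : |x| ^ 4 / (Nat.factorial 4 : ℕ) ≤ exp |x| :=
    pow_div_factorial_le_exp |x| (abs_nonneg x) 4
  have h2 : exp |x| ≤ 2 * cosh x := by
    have := exp_abs_le x
    rw [cosh_eq]
    linarith
  have h3 : |x| ^ 4 = x ^ 4 := Even.pow_abs (by decide) x
  have h4 : ((Nat.factorial 4 : ℕ) : ℝ) = 24 := by norm_num [Nat.factorial]
  rw [h3, h4] at h1
  have hc := cosh_pos x
  rw [logisticDensity_eq_inv_cosh, ← div_eq_mul_inv, ← div_eq_mul_inv,
    div_le_div_iff₀ (by positivity) (by positivity)]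
  nlinarith [sq_nonneg (x ^ 2 - 1)]

lemma integrable_mul_logisticDensity {p : ℝ → ℝ} (hp : Continuous p) (C : ℝ)
    (hC : ∀ x, |p x| ≤ C * (1 + x ^ 2)) : Integrable fun x => p x * logisticDensity x := by
  have hC0 : 0 ≤ C := by simpa using (abs_nonneg _).trans (hC 0)
  refine (integrable_inv_one_add_sq.const_mul (C * 48)).mono'
    (by fun_prop) (Filter.Eventually.of_forall fun x => ?_)
  rw [norm_mul, norm_eq_abs, norm_eq_abs, abs_of_nonneg (logisticDensity_nonneg x)]
  calc |p x| * logisticDensity x ≤ C * (1 + x ^ 2) * logisticDensity x :=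
        mul_le_mul_of_nonneg_right (hC x) (logisticDensity_nonneg x)
    _ = C * ((1 + x ^ 2) * logisticDensity x) := by ring
    _ ≤ C * (48 * (1 + x ^ 2)⁻¹) :=
        mul_le_mul_of_nonneg_left (one_add_sq_mul_logisticDensity_le x) hC0
    _ = C * 48 * (1 + x ^ 2)⁻¹ := by ring

lemma integrable_logisticDensity : Integrable logisticDensity := by
  simpa using integrable_mul_logisticDensity (p := fun _ => 1) continuous_const 1
    fun x => by rw [abs_one]; nlinarith [sq_nonneg x]

lemma integrable_id_mul_logisticDensity : Integrable fun x => x * logisticDensity x :=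
  integrable_mul_logisticDensity (p := fun x => x) continuous_id 1
    fun x => by rw [abs_le]; constructor <;> nlinarith [sq_nonneg (x - 1), sq_nonneg (x + 1)]

lemma integrable_sq_mul_logisticDensity : Integrable fun x => x ^ 2 * logisticDensity x :=
  integrable_mul_logisticDensity (p := fun x => x ^ 2) (by fun_prop) 1
    fun x => by rw [abs_of_nonneg (sq_nonneg x)]; linarith

lemma hasDerivAt_sigmoid_logisticDensity (x : ℝ) :
    HasDerivAt (fun y => 1 - (1 + exp y)⁻¹) (logisticDensity x) x := by
  refine ((((hasDerivAt_exp x).const_add 1).fun_inv (by positivity)).const_sub 1).congr_deriv ?_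
  rw [logisticDensity]
  ring

lemma integral_logisticDensity : ∫ x, logisticDensity x = 1 := by
  have hbot : Filter.Tendsto (fun y => 1 - (1 + exp y)⁻¹) Filter.atBot (nhds 0) := by
    have := ((tendsto_exp_atBot.const_add 1).inv₀ (by norm_num)).const_sub 1
    simpa using this
  have htop : Filter.Tendsto (fun y => 1 - (1 + exp y)⁻¹) Filter.atTop (nhds 1) := by
    have := (tendsto_inv_atTop_zero.comp
      (Filter.tendsto_atTop_add_const_left _ 1 tendsto_exp_atTop)).const_sub 1
    simpa [Function.comp_def] using this
  simpa using integral_of_hasDerivAt_of_tendsto hasDerivAt_sigmoid_logisticDensity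
    integrable_logisticDensity hbot htop

lemma integral_id_mul_logisticDensity : ∫ x, x * logisticDensity x = 0 := by
  have h := integral_neg_eq_self (fun x => x * logisticDensity x) volume
  simp only [logisticDensity_neg, neg_mul, integral_neg] at h
  linarith

lemma hasSum_neg_one_pow_div_sq :
    HasSum (fun n : ℕ => (-1) ^ n / (n : ℝ) ^ 2) (-(π ^ 2 / 12)) := by
  have hz := hasSum_zeta_two
  have heven : HasSum (fun k : ℕ => (1 : ℝ) / ((2 * k : ℕ) : ℝ) ^ 2) (π ^ 2 / 24) := by
    have hterm (k : ℕ) : (1 : ℝ) / ((2 * k : ℕ) : ℝ) ^ 2 = 1 / 4 * (1 / (k : ℝ) ^ 2) := by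
      push_cast
      rw [mul_pow, one_div_mul_one_div]
      norm_num
    have hval : π ^ 2 / 24 = 1 / 4 * (π ^ 2 / 6) := by ring
    simpa only [hterm, hval] using hz.mul_left (1 / 4)
  obtain ⟨s, hodd⟩ : Summable fun k : ℕ => (1 : ℝ) / ((2 * k + 1 : ℕ) : ℝ) ^ 2 :=
    hz.summable.comp_injective (i := fun k : ℕ => 2 * k + 1) fun a b h => by simpa using h
  have hs : π ^ 2 / 24 + s = π ^ 2 / 6 :=
    (HasSum.even_add_odd (f := fun n : ℕ => (1 : ℝ) / (n : ℝ) ^ 2) heven hodd).unique hz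
  have := HasSum.even_add_odd (f := fun n : ℕ => (-1) ^ n / (n : ℝ) ^ 2) (m := π ^ 2 / 24)
    (m' := -s) (by simpa [pow_mul] using heven) (by simpa [pow_succ, pow_mul, neg_div] using hodd.neg)
  convert this using 1
  linarith

lemma integral_sq_mul_exp_neg_nat_mul {n : ℕ} (hn : n ≠ 0) :
    ∫ x in Set.Ioi (0 : ℝ), x ^ 2 * exp (-(n * x)) = 2 / (n : ℝ) ^ 3 := by
  have h := integral_rpow_mul_exp_neg_mul_Ioi (a := 3) (r := n) (by norm_num) (by positivity)
  have hG : Gamma 3 = 2 := by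
    have := Gamma_nat_eq_factorial 2
    rw [Nat.factorial_two] at this
    convert this using 2 <;> norm_num
  norm_num [hG] at h
  rw [h]
  ring

lemma integral_Ioi_sq_mul_logisticDensity :
    ∫ x in Set.Ioi (0 : ℝ), x ^ 2 * logisticDensity x = π ^ 2 / 6 := by
  let F : ℕ → ℝ → ℝ := fun n x => -((-1) ^ n * n) * (x ^ 2 * exp (-(n * x)))
  have hF_integrable (n : ℕ) : IntegrableOn (F n) (Set.Ioi 0) := by
    rcases eq_or_ne n 0 with rfl | hn
    · simp [F]
    · refine Integrable.const_mul (Integrable.of_integral_ne_zero ?_) _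
      rw [integral_sq_mul_exp_neg_nat_mul hn]
      positivity
  have hF_integral (n : ℕ) :
      ∫ x in Set.Ioi (0 : ℝ), F n x = -2 * ((-1) ^ n / (n : ℝ) ^ 2) := by
    rcases eq_or_ne n 0 with rfl | hn
    · simp [F]
    · rw [integral_const_mul, integral_sq_mul_exp_neg_nat_mul hn]
      field_simp
  have hF_norm (n : ℕ) :
      ∫ x in Set.Ioi (0 : ℝ), ‖F n x‖ = 2 * (1 / (n : ℝ) ^ 2) := by
    have hnorm (x : ℝ) : ‖F n x‖ = n * (x ^ 2 * exp (-(n * x))) := by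
      simp [F]
    simp only [hnorm]
    rcases eq_or_ne n 0 with rfl | hn
    · simp
    · rw [integral_const_mul, integral_sq_mul_exp_neg_nat_mul hn]
      field_simp
  have hsum := hasSum_integral_of_summable_integral_norm hF_integrable
    (by simpa only [hF_norm] using hasSum_zeta_two.summable.mul_left 2)
  simp only [hF_integral] at hsum
  have hF_tsum : ∀ x ∈ Set.Ioi (0 : ℝ), ∑' n, F n x = x ^ 2 * logisticDensity x := by
    intro x hx
    have hr : ‖-exp (-x)‖ < 1 := by
      rw [norm_neg, norm_eq_abs, abs_exp, exp_lt_one_iff]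
      exact neg_lt_zero.mpr hx
    have h := (hasSum_coe_mul_geometric_of_norm_lt_one hr).mul_left (-x ^ 2)
    convert h.tsum_eq using 1
    · congr 1 with n
      rw [neg_pow, ← exp_nat_mul, mul_neg]
      simp only [F]
      ring
    · rw [← logisticDensity_neg, logisticDensity]
      ring
  rw [setIntegral_congr_fun measurableSet_Ioi hF_tsum] at hsum
  rw [hsum.unique (hasSum_neg_one_pow_div_sq.mul_left (-2))]
  ring

lemma integral_sq_mul_logisticDensity : ∫ x, x ^ 2 * logisticDensity x = π ^ 2 / 3 := by
  have h := integral_comp_abs (f := fun x => x ^ 2 * logisticDensity x)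
  rw [integral_Ioi_sq_mul_logisticDensity] at h
  have habs (x : ℝ) : |x| ^ 2 * logisticDensity |x| = x ^ 2 * logisticDensity x := by
    rw [sq_abs, logisticDensity_eq_inv_cosh, cosh_abs, ← logisticDensity_eq_inv_cosh]
  simp only [habs] at h
  rw [h]
  ring

lemma integrable_sub_sq_mul_logisticDensity (s : ℝ) :
    Integrable fun x => (x - s) ^ 2 * logisticDensity x :=
  integrable_mul_logisticDensity (p := fun x => (x - s) ^ 2) (by fun_prop) (2 * (1 + s ^ 2))
    fun x => by
      rw [abs_of_nonneg (sq_nonneg _)]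
      nlinarith [sq_nonneg (x + s), sq_nonneg (x * s)]

lemma integral_sub_sq_mul_logisticDensity (s : ℝ) :
    ∫ x, (x - s) ^ 2 * logisticDensity x = π ^ 2 / 3 + s ^ 2 := by
  have h (x : ℝ) : (x - s) ^ 2 * logisticDensity x = x ^ 2 * logisticDensity x
      - 2 * s * (x * logisticDensity x) + s ^ 2 * logisticDensity x := by ring
  simp only [h]
  rw [integral_add (integrable_sq_mul_logisticDensity.sub'
        (integrable_id_mul_logisticDensity.const_mul _))
      (integrable_logisticDensity.const_mul _),
    integral_sub integrable_sq_mul_logisticDensity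
      (integrable_id_mul_logisticDensity.const_mul _),
    integral_const_mul, integral_const_mul, integral_sq_mul_logisticDensity,
    integral_id_mul_logisticDensity, integral_logisticDensity]
  ring

lemma integrable_sq_mul_logisticDensity_add (s : ℝ) :
    Integrable fun u => u ^ 2 * logisticDensity (u + s) := by
  simpa using (integrable_sub_sq_mul_logisticDensity s).comp_add_right s

lemma integral_sq_mul_logisticDensity_add (s : ℝ) :
    ∫ u, u ^ 2 * logisticDensity (u + s) = π ^ 2 / 3 + s ^ 2 := by
  rw [← integral_sub_sq_mul_logisticDensity,
    ← integral_add_right_eq_self (fun x => (x - s) ^ 2 * logisticDensity x) s]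
  simp

lemma intervalIntegral_logisticDensity_add (t u : ℝ) :
    ∫ s in (-t)..t, logisticDensity (u + s) =
      2 * sinh t * (exp u / (exp (2 * u) + 2 * cosh t * exp u + 1)) := by
  rw [intervalIntegral.integral_comp_add_left logisticDensity u,
    intervalIntegral.integral_eq_sub_of_hasDerivAt
      (fun x _ => hasDerivAt_sigmoid_logisticDensity x)
      (continuous_logisticDensity.intervalIntegrable _ _)]
  have hu := exp_pos u
  have ht := exp_pos t
  rw [sinh_eq, cosh_eq, exp_add, exp_add, exp_neg, two_mul u, exp_add]
  have hden : exp u * exp u + 2 * ((exp t + (exp t)⁻¹) / 2) * exp u + 1 =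
      (1 + exp u * exp t) * (1 + exp u * (exp t)⁻¹) := by
    field_simp
    ring
  rw [hden]
  field_simp
  ring

lemma integral_sq_mul_exp_div_s6 (t : ℝ) :
    2 * sinh t * ∫ u, u ^ 2 * (exp u / (exp (2 * u) + 2 * cosh t * exp u + 1)) =
      2 * t * (π ^ 2 + t ^ 2) / 3 := by
  have hint : Integrable (Function.uncurry fun s u : ℝ => u ^ 2 * logisticDensity (u + s))
      ((volume.restrict (Set.uIoc (-t) t)).prod volume) := by
    rw [integrable_prod_iff (by unfold Function.uncurry; fun_prop)]
    refine ⟨Filter.Eventually.of_forall integrable_sq_mul_logisticDensity_add, ?_⟩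
    have hnorm (s u : ℝ) :
        ‖u ^ 2 * logisticDensity (u + s)‖ = u ^ 2 * logisticDensity (u + s) :=
      norm_of_nonneg (mul_nonneg (sq_nonneg u) (logisticDensity_nonneg _))
    simp only [Function.uncurry, hnorm, integral_sq_mul_logisticDensity_add]
    exact intervalIntegrable_iff.mp
      ((by fun_prop : Continuous fun s : ℝ => π ^ 2 / 3 + s ^ 2).intervalIntegrable _ _)
  have h := intervalIntegral_integral_swap hint
  simp only [integral_sq_mul_logisticDensity_add, intervalIntegral.integral_const_mul,
    intervalIntegral_logisticDensity_add] at h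
  rw [intervalIntegral.integral_add (by simp) (by simp), intervalIntegral.integral_const,
    integral_pow] at h
  rw [← integral_const_mul]
  simp only [mul_left_comm (2 * sinh t)]
  rw [← h]
  simp only [smul_eq_mul]
  norm_num
  ring

/-- For t > 0 and τ > 0, the second moment of the generalized
secant hyperbolic density equals τ², where a = cosh t, c₂ = √((π²+t²)/3),
c₁ = (sinh t / t)·c₂. -/
theorem gsh_second_moment_pos
    (t τ : ℝ) (ht : 0 < t) (hτ : 0 < τ)
    (a c₁ c₂ : ℝ)
    (ha : a = Real.cosh t)
    (hc₂ : c₂ = Real.sqrt ((Real.pi ^ 2 + t ^ 2) / 3))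
    (hc₁ : c₁ = (Real.sinh t / t) * c₂) :
    ∫ θ : ℝ, θ ^ 2 * ((c₁ / τ) * Real.exp (c₂ * θ / τ) /
      (Real.exp (2 * c₂ * θ / τ) + 2 * a * Real.exp (c₂ * θ / τ) + 1)) = τ ^ 2 := by
  have hc : 0 < c₂ := hc₂ ▸ sqrt_pos.mpr (by positivity)
  have hsq : c₂ ^ 2 = (π ^ 2 + t ^ 2) / 3 := by rw [hc₂, sq_sqrt (by positivity)]
  have hs : 0 < sinh t := sinh_pos_iff.mpr ht
  have key := integral_sq_mul_exp_div_s6 t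
  let f : ℝ → ℝ := fun u => u ^ 2 * (exp u / (exp (2 * u) + 2 * cosh t * exp u + 1))
  have hf (θ : ℝ) : θ ^ 2 * ((c₁ / τ) * exp (c₂ * θ / τ) /
      (exp (2 * c₂ * θ / τ) + 2 * a * exp (c₂ * θ / τ) + 1)) =
        (τ / c₂) ^ 2 * (c₁ / τ) * f (c₂ / τ * θ) := by
    have h₁ : c₂ / τ * θ = c₂ * θ / τ := by ring
    have h₂ : 2 * (c₂ * θ / τ) = 2 * c₂ * θ / τ := by ring
    simp only [f, ha, h₁, h₂]
    field_simp
  simp only [hf]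
  rw [integral_const_mul, Measure.integral_comp_mul_left, abs_of_pos (by positivity),
    smul_eq_mul, hc₁]
  have hJ : ∫ u, f u = t * c₂ ^ 2 / sinh t := by
    rw [hsq, eq_div_iff hs.ne']
    linarith
  rw [hJ]
  field_simp
end

section
/- For every t with −π < t < 0, the fourth moment of the generalized secant hyperbolic density with τ = 1 equals (21π² − 9t²)/(5π² − 5t²): ∫_ℝ θ⁴·g(θ;1,t) dθ = (21π² − 9t²)/(5π² − 5t²), where g(θ;1,t) = c₁·exp(c₂θ)/(exp(2c₂θ) + 2a·exp(c₂θ) + 1) with a = cos t, c₂ = √((π²−t²)/3), c₁ = (sin t / t)·c₂. Since this density has mean 0 and variance 1, this value equals its coefficient of kurtosis β(t). -/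
open Real MeasureTheory

/-- The Poisson-type series `∑ rⁿ⁺¹ sin ((n+1) x)`. -/
lemma hasSum_pow_succ_mul_sin {r : ℝ} (hr₀ : 0 ≤ r) (hr₁ : r < 1) (x : ℝ) :
    HasSum (fun n : ℕ => r ^ (n + 1) * Real.sin ((n + 1) * x))
      (r * Real.sin x / (1 - 2 * r * Real.cos x + r ^ 2)) := by
  set z : ℂ := r * Complex.exp (x * Complex.I) with hz
  have hnorm : ‖z‖ < 1 := by
    rw [hz, norm_mul, Complex.norm_exp_ofReal_mul_I, Complex.norm_real, Real.norm_eq_abs,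
      abs_of_nonneg hr₀, mul_one]
    exact hr₁
  have hre : z.re = r * Real.cos x := by
    rw [hz, Complex.re_ofReal_mul, Complex.exp_ofReal_mul_I_re]
  have him : z.im = r * Real.sin x := by
    rw [hz, Complex.im_ofReal_mul, Complex.exp_ofReal_mul_I_im]
  have key := Complex.hasSum_im ((hasSum_geometric_of_norm_lt_one hnorm).mul_left z)
  have hterm : (fun n : ℕ => (z * z ^ n).im) =
      fun n : ℕ => r ^ (n + 1) * Real.sin ((n + 1) * x) := by
    funext n
    have : z * z ^ n
        = ((r ^ (n + 1) : ℝ) : ℂ) * Complex.exp ((((n + 1 : ℝ) * x : ℝ) : ℂ) * Complex.I) := by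
      rw [← pow_succ', hz, mul_pow, ← Complex.exp_nat_mul]
      push_cast
      ring_nf
    rw [this, Complex.im_ofReal_mul, Complex.exp_ofReal_mul_I_im]
  have hval : (z * (1 - z)⁻¹).im = r * Real.sin x / (1 - 2 * r * Real.cos x + r ^ 2) := by
    have hsq : Complex.normSq (1 - z) = 1 - 2 * r * Real.cos x + r ^ 2 := by
      rw [Complex.normSq_apply]
      simp only [Complex.sub_re, Complex.sub_im, Complex.one_re, Complex.one_im, hre, him]
      linear_combination r ^ 2 * Real.sin_sq_add_cos_sq x
    rw [Complex.mul_im, Complex.inv_re, Complex.inv_im, hsq]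
    simp only [Complex.sub_re, Complex.sub_im, Complex.one_re, Complex.one_im, hre, him]
    ring
  rw [hterm, hval] at key
  exact key

lemma integral_pow_mul_exp_neg_mul_Ioi (m : ℕ) {r : ℝ} (hr : 0 < r) :
    ∫ u in Set.Ioi (0 : ℝ), u ^ m * Real.exp (-(r * u)) = m.factorial / r ^ (m + 1) := by
  have h := Real.integral_rpow_mul_exp_neg_mul_Ioi (a := (m : ℝ) + 1) (by positivity) hr
  rw [Real.Gamma_nat_eq_factorial, add_sub_cancel_right] at h
  simp only [Real.rpow_natCast] at h
  rw [h]
  norm_cast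
  rw [one_div, inv_pow]
  ring

lemma integrableOn_pow_mul_exp_neg_mul_Ioi (m : ℕ) {r : ℝ} (hr : 0 < r) :
    IntegrableOn (fun u : ℝ => u ^ m * Real.exp (-(r * u))) (Set.Ioi 0) :=
  .of_integral_ne_zero (by rw [integral_pow_mul_exp_neg_mul_Ioi m hr]; positivity)

lemma hasSum_integral_pow_mul_poisson {m : ℕ} (hm : 1 ≤ m) (x : ℝ) :
    HasSum (fun n : ℕ => (m.factorial : ℝ) * (1 / (n : ℝ) ^ (m + 1) * Real.sin (n * x)))
      (∫ u in Set.Ioi (0 : ℝ), u ^ m * (Real.exp (-u) * Real.sin x /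
        (1 - 2 * Real.exp (-u) * Real.cos x + Real.exp (-u) ^ 2))) := by
  rw [← hasSum_nat_add_iff' 1]
  simp only [Finset.sum_range_one, Nat.cast_zero, zero_mul, Real.sin_zero, mul_zero, sub_zero,
    Nat.cast_add, Nat.cast_one]
  have hpos (n : ℕ) : (0 : ℝ) < n + 1 := by positivity
  have hint (n : ℕ) := integrableOn_pow_mul_exp_neg_mul_Ioi m (hpos n)
  have hF (n : ℕ) : ∫ u in Set.Ioi (0 : ℝ),
      u ^ m * Real.exp (-((n + 1) * u)) * Real.sin ((n + 1) * x) =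
        m.factorial * (1 / ((n : ℝ) + 1) ^ (m + 1) * Real.sin ((n + 1) * x)) := by
    rw [integral_mul_const, integral_pow_mul_exp_neg_mul_Ioi m (hpos n)]
    ring
  have hnorm (n : ℕ) : ∫ u in Set.Ioi (0 : ℝ),
      ‖u ^ m * Real.exp (-((n + 1) * u)) * Real.sin ((n + 1) * x)‖ =
        m.factorial / ((n : ℝ) + 1) ^ (m + 1) * |Real.sin ((n + 1) * x)| := by
    rw [← integral_pow_mul_exp_neg_mul_Ioi m (hpos n), ← integral_mul_const]
    refine setIntegral_congr_fun measurableSet_Ioi fun u (hu : 0 < u) => ?_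
    rw [norm_mul, Real.norm_eq_abs, Real.norm_eq_abs, abs_of_pos (by positivity)]
  have hsum : Summable fun n : ℕ => ∫ u in Set.Ioi (0 : ℝ),
      ‖u ^ m * Real.exp (-((n + 1) * u)) * Real.sin ((n + 1) * x)‖ := by
    have hs : Summable fun n : ℕ => (m.factorial : ℝ) * (1 / ((n + 1 : ℕ) : ℝ) ^ (m + 1)) :=
      ((summable_nat_add_iff 1).2
        (Real.summable_one_div_nat_pow.2 (by omega : 1 < m + 1))).mul_left _
    refine hs.of_nonneg_of_le (fun n => integral_nonneg fun u => norm_nonneg _) fun n => ?_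
    rw [hnorm, mul_one_div, Nat.cast_add, Nat.cast_one]
    exact mul_le_of_le_one_right (by positivity) (Real.abs_sin_le_one _)
  have key := hasSum_integral_of_summable_integral_norm
    (fun n : ℕ => (hint n).mul_const (Real.sin ((n + 1) * x))) hsum
  simp only [hF] at key
  convert key using 1
  refine setIntegral_congr_fun measurableSet_Ioi fun u (hu : 0 < u) => ?_
  have h := (hasSum_pow_succ_mul_sin (Real.exp_nonneg (-u))
    (Real.exp_lt_one_iff.2 (neg_lt_zero.2 hu)) x).mul_left (u ^ m)
  rw [← h.tsum_eq]
  refine tsum_congr fun n => ?_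
  rw [← Real.exp_nat_mul, ← mul_assoc]
  push_cast
  rw [mul_neg]

lemma eval_map_bernoulli_five (y : ℝ) :
    ((Polynomial.bernoulli 5).map (algebraMap ℚ ℝ)).eval y =
      y ^ 5 - 5 / 2 * y ^ 4 + 5 / 3 * y ^ 3 - 1 / 6 * y := by
  have h3 : bernoulli 3 = 0 := bernoulli_eq_zero_of_odd (by decide) (by norm_num)
  have h5 : bernoulli 5 = 0 := bernoulli_eq_zero_of_odd (by decide) (by norm_num)
  have h4 : bernoulli 4 = -1 / 30 := by
    rw [bernoulli_eq_bernoulli'_of_ne_one (by norm_num), bernoulli'_four]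
  have hc : Nat.choose 5 2 = 10 := by decide
  simp [Polynomial.bernoulli, Finset.sum_range_succ, h3, h4, h5, hc, bernoulli_one,
    bernoulli_two, Polynomial.map_monomial, Polynomial.eval_monomial]
  ring

lemma hasSum_sin_div_pow_five {x : ℝ} (hx : x ∈ Set.Icc 0 (2 * Real.pi)) :
    HasSum (fun n : ℕ => 1 / (n : ℝ) ^ 5 * Real.sin (n * x))
      (Real.pi ^ 4 * x / 90 - Real.pi ^ 2 * x ^ 3 / 36 + Real.pi * x ^ 4 / 48 - x ^ 5 / 240) := by
  have hpi := Real.pi_pos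
  have hy : x / (2 * Real.pi) ∈ Set.Icc (0 : ℝ) 1 :=
    ⟨by have := hx.1; positivity, (div_le_one (by positivity)).2 hx.2⟩
  have h := hasSum_one_div_nat_pow_mul_sin (k := 2) two_ne_zero hy
  simp only [Nat.reduceMul, Nat.reduceAdd, eval_map_bernoulli_five] at h
  convert h using 1
  · funext n
    congr 2
    field_simp
  · simp only [Nat.factorial]
    push_cast
    field_simp
    ring

lemma integral_pow_four_mul_logistic_kernel {t : ℝ} (ht₁ : -Real.pi < t) (ht₂ : t < 0) :
    ∫ u : ℝ, u ^ 4 * (Real.exp u / (Real.exp (2 * u) + 2 * Real.cos t * Real.exp u + 1)) =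
      t / Real.sin t * ((Real.pi ^ 2 - t ^ 2) * (7 * Real.pi ^ 2 - 3 * t ^ 2) / 15) := by
  have hsin : Real.sin t ≠ 0 := (Real.sin_neg_of_neg_of_neg_pi_lt ht₂ ht₁).ne
  have hsymm (u : ℝ) :
      u ^ 4 * (Real.exp u / (Real.exp (2 * u) + 2 * Real.cos t * Real.exp u + 1)) =
        u ^ 4 * (Real.exp (-u) / (1 + 2 * Real.cos t * Real.exp (-u) + Real.exp (-u) ^ 2)) := by
    have he := Real.exp_pos u
    rw [Real.exp_neg, two_mul u, Real.exp_add]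
    congr 1
    rw [show Real.exp u * Real.exp u + 2 * Real.cos t * Real.exp u + 1 = Real.exp u ^ 2 *
      (1 + 2 * Real.cos t * (Real.exp u)⁻¹ + (Real.exp u)⁻¹ ^ 2) by field_simp]
    rw [← div_div]
    congr 1
    field_simp
  have heven (u : ℝ) :
      u ^ 4 * (Real.exp u / (Real.exp (2 * u) + 2 * Real.cos t * Real.exp u + 1)) =
        |u| ^ 4 * (Real.exp (-|u|) /
          (1 + 2 * Real.cos t * Real.exp (-|u|) + Real.exp (-|u|) ^ 2)) := by
    rcases le_total 0 u with hu | hu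
    · rw [abs_of_nonneg hu, hsymm]
    · rw [abs_of_nonpos hu, neg_neg, ← Real.exp_nat_mul, Even.neg_pow (by decide)]
      push_cast
      ring_nf
  have hS := (hasSum_integral_pow_mul_poisson (m := 4) (by norm_num) (t + Real.pi)).unique
    ((hasSum_sin_div_pow_five (x := t + Real.pi) ⟨by linarith, by linarith⟩).mul_left _)
  have hI : ∫ u in Set.Ioi (0 : ℝ), u ^ 4 * (Real.exp (-u) * Real.sin (t + Real.pi) /
        (1 - 2 * Real.exp (-u) * Real.cos (t + Real.pi) + Real.exp (-u) ^ 2)) =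
      (-Real.sin t) * ∫ u in Set.Ioi (0 : ℝ), u ^ 4 * (Real.exp (-u) /
        (1 + 2 * Real.cos t * Real.exp (-u) + Real.exp (-u) ^ 2)) := by
    rw [← integral_const_mul]
    refine integral_congr_ae (.of_forall fun u => ?_)
    simp only [Real.sin_add_pi, Real.cos_add_pi]
    ring
  rw [hI] at hS
  simp only [heven]
  rw [integral_comp_abs (f := fun u : ℝ => u ^ 4 * (Real.exp (-u) /
    (1 + 2 * Real.cos t * Real.exp (-u) + Real.exp (-u) ^ 2)))]
  rw [div_mul_eq_mul_div, eq_div_iff hsin]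
  norm_num [Nat.factorial] at hS
  linear_combination (-2) * hS

/-- For −π < t < 0, the fourth moment (= coefficient of
kurtosis, since the density has mean 0 and variance 1) of the generalized
secant hyperbolic density with τ = 1 equals (21π² − 9t²)/(5π² − 5t²), where
a = cos t, c₂ = √((π²−t²)/3), c₁ = (sin t / t)·c₂. -/
theorem gsh_fourth_moment_neg
    (t : ℝ) (ht₁ : -Real.pi < t) (ht₂ : t < 0)
    (a c₁ c₂ : ℝ)
    (ha : a = Real.cos t)
    (hc₂ : c₂ = Real.sqrt ((Real.pi ^ 2 - t ^ 2) / 3))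
    (hc₁ : c₁ = (Real.sin t / t) * c₂) :
    ∫ θ : ℝ, θ ^ 4 * (c₁ * Real.exp (c₂ * θ) /
        (Real.exp (2 * c₂ * θ) + 2 * a * Real.exp (c₂ * θ) + 1)) =
      (21 * Real.pi ^ 2 - 9 * t ^ 2) / (5 * Real.pi ^ 2 - 5 * t ^ 2) := by
  have hsin : Real.sin t ≠ 0 := (Real.sin_neg_of_neg_of_neg_pi_lt ht₂ ht₁).ne
  have hd : 0 < Real.pi ^ 2 - t ^ 2 := by nlinarith
  have hc : 0 < c₂ := hc₂ ▸ Real.sqrt_pos.2 (by positivity)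
  have hc_sq : c₂ ^ 2 = (Real.pi ^ 2 - t ^ 2) / 3 := by
    rw [hc₂, Real.sq_sqrt (by positivity)]
  have hscale := Measure.integral_comp_mul_left (fun u : ℝ =>
    u ^ 4 * (Real.exp u / (Real.exp (2 * u) + 2 * Real.cos t * Real.exp u + 1))) c₂
  rw [integral_pow_four_mul_logistic_kernel ht₁ ht₂, abs_of_pos (inv_pos.2 hc),
    smul_eq_mul] at hscale
  have hpt (θ : ℝ) : θ ^ 4 * (c₁ * Real.exp (c₂ * θ) /
        (Real.exp (2 * c₂ * θ) + 2 * a * Real.exp (c₂ * θ) + 1)) =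
      c₁ / c₂ ^ 4 * ((c₂ * θ) ^ 4 * (Real.exp (c₂ * θ) /
        (Real.exp (2 * (c₂ * θ)) + 2 * Real.cos t * Real.exp (c₂ * θ) + 1))) := by
    rw [ha, mul_assoc 2 c₂ θ, mul_pow]
    field_simp
  simp only [hpt]
  rw [integral_const_mul, hscale, hc₁]
  have hcoef : Real.sin t / t * c₂ / c₂ ^ 4 * (c₂⁻¹ * (t / Real.sin t *
      ((Real.pi ^ 2 - t ^ 2) * (7 * Real.pi ^ 2 - 3 * t ^ 2) / 15))) =
      ((Real.pi ^ 2 - t ^ 2) * (7 * Real.pi ^ 2 - 3 * t ^ 2) / 15) / (c₂ ^ 2) ^ 2 := by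
    have := ht₂.ne
    field_simp
  rw [hcoef, hc_sq, show 5 * Real.pi ^ 2 - 5 * t ^ 2 = 5 * (Real.pi ^ 2 - t ^ 2) by ring]
  field_simp
  ring
end

section
/- For every fixed θ ∈ ℝ with |θ| ≠ √3, the generalized secant hyperbolic density with τ = 1 converges pointwise as t → +∞ to the uniform density on (−√3, √3): lim_{t→+∞} g(θ;1,t) = 1/(2√3) if |θ| < √3, and lim_{t→+∞} g(θ;1,t) = 0 if |θ| > √3, where g(θ;1,t) = c₁·exp(c₂θ)/(exp(2c₂θ) + 2a·exp(c₂θ) + 1) with a = cosh t, c₂ = √((π²+t²)/3), c₁ = (sinh t / t)·c₂. -/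
open Real Filter Topology

/-- The ratio of the scale constant `√((π² + t²) / 3)` to `t` tends to `1 / √3`. -/
lemma tendsto_sqrt_pi_sq_add_sq_div :
    Tendsto (fun t : ℝ => √((π ^ 2 + t ^ 2) / 3) / t) atTop (𝓝 (1 / √3)) := by
  have h : Tendsto (fun t : ℝ => √((π ^ 2 * (t⁻¹) ^ 2 + 1) / 3)) atTop (𝓝 (1 / √3)) := by
    have h0 : Tendsto (fun t : ℝ => (π ^ 2 * (t⁻¹) ^ 2 + 1) / 3) atTop
        (𝓝 ((π ^ 2 * 0 ^ 2 + 1) / 3)) :=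
      (((tendsto_inv_atTop_zero.pow 2).const_mul _).add_const 1).div_const 3
    have h1 := (Real.continuous_sqrt.tendsto _).comp h0
    have e : √((π ^ 2 * 0 ^ 2 + 1) / 3) = 1 / √3 := by simp
    rwa [e] at h1
  refine h.congr' ?_
  filter_upwards [eventually_gt_atTop 0] with t ht
  have e : (π ^ 2 * (t⁻¹) ^ 2 + 1) / 3 = ((π ^ 2 + t ^ 2) / 3) / t ^ 2 := by
    field_simp
  rw [e, Real.sqrt_div' _ (sq_nonneg t), Real.sqrt_sq ht.le]

/-- The GSH density with the dominant factor `exp t` cancelled. -/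
lemma gsh_eq_mul_div (s t θ : ℝ) :
    ((sinh t / t) * s) * exp (s * θ) / (exp (2 * s * θ) + 2 * cosh t * exp (s * θ) + 1) =
      (s / t) * ((1 - exp (-2 * t)) / 2) /
        (exp (s * |θ| - t) + exp (-(s * |θ|) - t) + (1 + exp (-2 * t))) := by
  have habs : exp (s * |θ| - t) + exp (-(s * |θ|) - t) =
      exp (s * θ - t) + exp (-(s * θ) - t) := by
    rcases abs_cases θ with ⟨h, -⟩ | ⟨h, -⟩
    · rw [h]
    · rw [h, mul_neg, neg_neg, add_comm]
  have hden : exp (2 * s * θ) + 2 * cosh t * exp (s * θ) + 1 =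
      (exp (s * θ - t) + exp (-(s * θ) - t) + (1 + exp (-2 * t))) *
        (exp (s * θ) * exp t) := by
    rw [cosh_eq]
    simp only [add_mul, ← exp_add, one_mul, mul_div_cancel₀, ne_eq,
      OfNat.ofNat_ne_zero, not_false_eq_true]
    ring_nf
    simp only [exp_zero]
    ring_nf
  have hnum : ((sinh t / t) * s) * exp (s * θ) =
      (s / t) * ((1 - exp (-2 * t)) / 2) * (exp (s * θ) * exp t) := by
    have hs : sinh t = (1 - exp (-2 * t)) / 2 * exp t := by
      rw [sinh_eq, div_mul_eq_mul_div, sub_mul, ← exp_add]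
      ring_nf
    rw [hs]
    ring
  rw [habs, hden, hnum, mul_div_mul_right _ _ (by positivity)]

/-- For every fixed θ with |θ| ≠ √3, the generalized secant
hyperbolic density with τ = 1 and shape parameter t > 0 (a = cosh t,
c₂ = √((π²+t²)/3), c₁ = (sinh t / t)·c₂) converges pointwise, as t → +∞, to
the uniform density on (−√3, √3). -/
theorem gsh_tendsto_uniform (θ : ℝ) (hθ : |θ| ≠ Real.sqrt 3) :
    (|θ| < Real.sqrt 3 →
      Tendsto (fun t : ℝ =>
          ((Real.sinh t / t) * Real.sqrt ((Real.pi ^ 2 + t ^ 2) / 3)) *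
            Real.exp (Real.sqrt ((Real.pi ^ 2 + t ^ 2) / 3) * θ) /
            (Real.exp (2 * Real.sqrt ((Real.pi ^ 2 + t ^ 2) / 3) * θ) +
              2 * Real.cosh t * Real.exp (Real.sqrt ((Real.pi ^ 2 + t ^ 2) / 3) * θ) + 1))
        atTop (𝓝 (1 / (2 * Real.sqrt 3)))) ∧
    (Real.sqrt 3 < |θ| →
      Tendsto (fun t : ℝ =>
          ((Real.sinh t / t) * Real.sqrt ((Real.pi ^ 2 + t ^ 2) / 3)) *
            Real.exp (Real.sqrt ((Real.pi ^ 2 + t ^ 2) / 3) * θ) /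
            (Real.exp (2 * Real.sqrt ((Real.pi ^ 2 + t ^ 2) / 3) * θ) +
              2 * Real.cosh t * Real.exp (Real.sqrt ((Real.pi ^ 2 + t ^ 2) / 3) * θ) + 1))
        atTop (𝓝 0)) := by
  have hr := tendsto_sqrt_pi_sq_add_sq_div
  have hE : Tendsto (fun t : ℝ => exp (-2 * t)) atTop (𝓝 0) :=
    tendsto_exp_atBot.comp (tendsto_id.const_mul_atTop_of_neg (by norm_num))
  have hnum : Tendsto (fun t : ℝ => √((π ^ 2 + t ^ 2) / 3) / t * ((1 - exp (-2 * t)) / 2))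
      atTop (𝓝 (1 / √3 * ((1 - 0) / 2))) :=
    hr.mul ((hE.const_sub 1).div_const 2)
  have hlin : Tendsto (fun t : ℝ => √((π ^ 2 + t ^ 2) / 3) / t * |θ| - 1) atTop
      (𝓝 (1 / √3 * |θ| - 1)) := (hr.mul_const _).sub_const 1
  have hexponent : (fun t : ℝ => t * (√((π ^ 2 + t ^ 2) / 3) / t * |θ| - 1)) =ᶠ[atTop]
      fun t => √((π ^ 2 + t ^ 2) / 3) * |θ| - t := by
    filter_upwards [eventually_gt_atTop 0] with t ht
    field_simp
  have h3 : 0 < √3 := by positivity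
  simp only [gsh_eq_mul_div]
  constructor
  · intro h
    have hneg : 1 / √3 * |θ| - 1 < 0 := by
      rw [one_div_mul_eq_div, sub_neg, div_lt_one h3]
      exact h
    have hplus : Tendsto (fun t : ℝ => exp (√((π ^ 2 + t ^ 2) / 3) * |θ| - t)) atTop (𝓝 0) :=
      tendsto_exp_atBot.comp ((tendsto_id.atTop_mul_neg hneg hlin).congr' hexponent)
    have hminus : Tendsto (fun t : ℝ => exp (-(√((π ^ 2 + t ^ 2) / 3) * |θ|) - t)) atTop
        (𝓝 0) := by
      refine squeeze_zero (fun t => (exp_pos _).le) (fun t => exp_le_exp.2 ?_) hplus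
      have : 0 ≤ √((π ^ 2 + t ^ 2) / 3) * |θ| := by positivity
      linarith
    have key := hnum.div ((hplus.add hminus).add (hE.const_add 1)) (by norm_num)
    have e : 1 / √3 * ((1 - 0) / 2) / (0 + 0 + (1 + 0)) = 1 / (2 * √3) := by
      field_simp
      norm_num
    rwa [e] at key
  · intro h
    have hpos : 0 < 1 / √3 * |θ| - 1 := by
      rw [one_div_mul_eq_div, sub_pos, one_lt_div h3]
      exact h
    have hplus : Tendsto (fun t : ℝ => exp (√((π ^ 2 + t ^ 2) / 3) * |θ| - t)) atTop atTop :=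
      tendsto_exp_atTop.comp ((tendsto_id.atTop_mul_pos hpos hlin).congr' hexponent)
    refine hnum.div_atTop (tendsto_atTop_mono (fun t => ?_) hplus)
    have h1 := exp_pos (-(√((π ^ 2 + t ^ 2) / 3) * |θ|) - t)
    have h2 := exp_pos (-2 * t)
    linarith
end
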